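/- arXiv:hep-th/9510068 — 4 statements merged into one kernel-verified Lean document; each statement's English description precedes it below -/
import Mathlib

section
/- Assume the twisted CAR hypotheses. Then for all f, g ∈ K one has b(f) * star(b(g)) * b(f) = ⟪g, f⟫ • b(f). In particular (taking g = f and using relation (i) with g = f, which gives b(u f) * b(f) = 0), b(f) * star(b(f)) * b(f) = ‖f‖² • b(f). -/
open scoped InnerProductSpace

theorem twisted_CAR_triple_product
    {A : Type*} [Ring A] [Algebra ℂ A] [StarRing A]
    {K : Type*} [NormedAddCommGroup K] [InnerProductSpace ℂ K] [CompleteSpace K]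
    (u : K ≃ₗᵢ[ℂ] K) (b : K →ₗ[ℂ] A)
    (hanti : ∀ f g : K, b (u f) * b g + b (u g) * b f = 0)
    (hcar : ∀ f h : K,
      b f * star (b h) + star (b (u h)) * b (u f) = (⟪h, f⟫_ℂ : ℂ) • (1 : A)) :
    (∀ f g : K, b f * star (b g) * b f = (⟪g, f⟫_ℂ : ℂ) • b f) ∧
      (∀ f : K, b f * star (b f) * b f = ((‖f‖ : ℂ) ^ 2) • b f) := by
  have hsq (f : K) : b (u f) * b f = 0 := by
    have h : (2 : ℂ) • (b (u f) * b f) = 0 := by rw [two_smul, hanti]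
    exact (smul_eq_zero_iff_right two_ne_zero).mp h
  have htriple (f g : K) : b f * star (b g) * b f = (⟪g, f⟫_ℂ : ℂ) • b f := by
    have h := congrArg (· * b f) (hcar f g)
    simpa only [add_mul, mul_assoc, hsq, mul_zero, add_zero, smul_mul_assoc, one_mul] using h
  refine ⟨htriple, fun f => ?_⟩
  rw [htriple, inner_self_eq_norm_sq_to_K]
  rfl
end

section
/- Let A be a unital complex *-algebra, n a natural number, and W, W', b : Fin n → A families of elements such that: (1) every b i and every star(b i) commutes with every W j and every W' j; (2) for all i, j: star(b i) * b j + b j * star(b i) = (if i = j then 1 else 0); (3) for all i, j: b i * b j + b j * b i = 0; and (4) for all i, j: star(W i) * W j = W' j * star(W' i). Then, writing X = Σ_i W i * b i and Y = Σ_i W' i * b i, one has star(X) * X + Y * star(Y) = Σ_i star(W i) * W i. -/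
theorem dressed_fermion_sum_identity
    {A : Type*} [Ring A] [Algebra ℂ A] [StarRing A]
    (n : ℕ) (W W' b : Fin n → A)
    (hcomm : ∀ i j : Fin n,
      Commute (b i) (W j) ∧ Commute (b i) (W' j) ∧
      Commute (star (b i)) (W j) ∧ Commute (star (b i)) (W' j))
    (hcar : ∀ i j : Fin n,
      star (b i) * b j + b j * star (b i) = if i = j then (1 : A) else 0)
    (hanti : ∀ i j : Fin n, b i * b j + b j * b i = 0)
    (hweyl : ∀ i j : Fin n, star (W i) * W j = W' j * star (W' i)) :
    star (∑ i : Fin n, W i * b i) * (∑ i : Fin n, W i * b i) +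
      (∑ i : Fin n, W' i * b i) * star (∑ i : Fin n, W' i * b i) =
      ∑ i : Fin n, star (W i) * W i := by
  have key (i j : Fin n) :
      star (b i) * star (W i) * (W j * b j) + W' j * b j * (star (b i) * star (W' i)) =
        star (W i) * W j * (star (b i) * b j + b j * star (b i)) := by
    have h₁ : Commute (star (b i)) (star (W i)) := (hcomm i i).1.star_star
    have h₂ : Commute (star (b i)) (W j) := (hcomm i j).2.2.1
    have h₃ : Commute (star (b i)) (star (W' i)) := (hcomm i i).2.1.star_star
    have h₄ : Commute (b j) (star (W' i)) := by
      simpa using (hcomm j i).2.2.2.star_star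
    have h₅ : star (b i) * star (W i) * (W j * b j) =
        star (W i) * W j * (star (b i) * b j) := by
      simpa only [mul_assoc] using congrArg (· * b j) (h₁.mul_right h₂).eq
    have h₆ : W' j * b j * (star (b i) * star (W' i)) =
        W' j * star (W' i) * (b j * star (b i)) := by
      simpa only [mul_assoc] using congrArg (W' j * ·) (h₄.mul_left h₃).eq
    rw [h₅, h₆, ← hweyl, ← mul_add]
  simp only [star_sum, star_mul, Finset.sum_mul_sum]
  rw [Finset.sum_comm (f := fun i j => W' i * b i * (star (b j) * star (W' j))),
    ← Finset.sum_add_distrib]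
  simp only [← Finset.sum_add_distrib, key, hcar]
  simp
end

section
/- Let H be a complex Hilbert space and W, W', b : ℕ → (H →L[ℂ] H) sequences of bounded operators such that: (1) every b i and every (b i)* commutes with every W j and every W' j; (2) for all i, j: (b i)* ∘ b j + b j ∘ (b i)* = (if i = j then id else 0); (3) for all i, j: b i ∘ b j + b j ∘ b i = 0; (4) for all i, j: (W i)* ∘ W j = W' j ∘ (W' i)*; and (5) there is a constant c ≥ 0 such that for every ψ ∈ H the family (‖W i ψ‖²)_{i∈ℕ} is summable with Σ_i ‖W i ψ‖² ≤ c · ‖ψ‖². Then for every ψ ∈ H the sequence of partial sums Σ_{i<n} W i (b i ψ) converges in H as n → ∞, the resulting map T : H → H is a bounded linear operator, and ‖T‖ ≤ √c. -/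
open ContinuousLinearMap Filter

/-- The canonical anticommutation relations turn the square of a dressed fermion sum into a sum of
squares of the dressing elements, up to a positive term. -/
theorem star_sum_mul_sum_add_of_car {A ι : Type*} [Ring A] [StarRing A] [DecidableEq ι]
    (W W' b : ι → A)
    (hW : ∀ i j, Commute (b i) (W j)) (hW' : ∀ i j, Commute (b i) (W' j))
    (hsW : ∀ i j, Commute (star (b i)) (W j)) (hsW' : ∀ i j, Commute (star (b i)) (W' j))
    (hcar : ∀ i j, star (b i) * b j + b j * star (b i) = if i = j then 1 else 0)
    (hweyl : ∀ i j, star (W i) * W j = W' j * star (W' i)) (s : Finset ι) :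
    star (∑ i ∈ s, W i * b i) * (∑ i ∈ s, W i * b i) +
      (∑ i ∈ s, W' i * b i) * star (∑ i ∈ s, W' i * b i) = ∑ i ∈ s, star (W i) * W i := by
  have h₁ (i j : ι) : star (W i * b i) * (W j * b j) =
      star (W i) * W j * (star (b i) * b j) := by
    rw [(hW i i).eq.symm, star_mul, mul_assoc, ← mul_assoc _ (W j), (hsW i j).eq]
    simp only [mul_assoc]
  have h₂ (i j : ι) : W' j * b j * star (W' i * b i) =
      star (W i) * W j * (b j * star (b i)) := by
    have h : Commute (b j) (star (W' i)) := by simpa using (hsW' j i).star_star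
    rw [(hW' i i).eq.symm, star_mul, hweyl, mul_assoc, ← mul_assoc (b j), h.eq]
    simp only [mul_assoc]
  simp only [star_sum, Finset.sum_mul_sum]
  rw [Finset.sum_comm (f := fun i j => W' i * b i * star (W' j * b j)), ← Finset.sum_add_distrib]
  refine Finset.sum_congr rfl fun i hi => ?_
  rw [← Finset.sum_add_distrib]
  simp only [h₁, h₂, ← mul_add, hcar]
  simp [hi]

theorem norm_sum_dressed_fermion_sq_le {H ι : Type*} [NormedAddCommGroup H]
    [InnerProductSpace ℂ H] [CompleteSpace H] [DecidableEq ι] (W W' b : ι → H →L[ℂ] H)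
    (hW : ∀ i j, Commute (b i) (W j)) (hW' : ∀ i j, Commute (b i) (W' j))
    (hsW : ∀ i j, Commute (adjoint (b i)) (W j)) (hsW' : ∀ i j, Commute (adjoint (b i)) (W' j))
    (hcar : ∀ i j, adjoint (b i) * b j + b j * adjoint (b i) = if i = j then 1 else 0)
    (hweyl : ∀ i j, adjoint (W i) * W j = W' j * adjoint (W' i)) (s : Finset ι) (ψ : H) :
    ‖∑ i ∈ s, W i (b i ψ)‖ ^ 2 ≤ ∑ i ∈ s, ‖W i ψ‖ ^ 2 := by
  have key := star_sum_mul_sum_add_of_car W W' b hW hW' hsW hsW' hcar hweyl s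
  set S := ∑ i ∈ s, W i * b i with hS
  set R := ∑ i ∈ s, W' i * b i
  have h := congrArg (fun T : H →L[ℂ] H => (inner ℂ (T ψ) ψ).re) key
  simp only [star_eq_adjoint, add_apply, sum_apply, mul_def, comp_apply, inner_add_left, sum_inner,
    Complex.add_re, Complex.re_sum, adjoint_inner_left] at h
  rw [← adjoint_inner_right R] at h
  have hn (x : H) : (inner ℂ x x).re = ‖x‖ ^ 2 := inner_self_eq_norm_sq (𝕜 := ℂ) x
  simp only [hn] at h
  have hSψ : S ψ = ∑ i ∈ s, W i (b i ψ) := by simp [hS, sum_apply]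
  rw [← hSψ, ← h]
  exact le_add_of_nonneg_right (sq_nonneg _)

theorem strong_limit_of_dressed_fermion_sums
    {H : Type*} [NormedAddCommGroup H] [InnerProductSpace ℂ H] [CompleteSpace H]
    (W W' b : ℕ → H →L[ℂ] H)
    (hcomm : ∀ i j : ℕ,
      Commute (b i) (W j) ∧ Commute (b i) (W' j) ∧
      Commute (adjoint (b i)) (W j) ∧ Commute (adjoint (b i)) (W' j))
    (hcar : ∀ i j : ℕ,
      adjoint (b i) * b j + b j * adjoint (b i) =
        if i = j then (1 : H →L[ℂ] H) else 0)
    (hanti : ∀ i j : ℕ, b i * b j + b j * b i = 0)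
    (hweyl : ∀ i j : ℕ, adjoint (W i) * W j = W' j * adjoint (W' i))
    (c : ℝ) (hc : 0 ≤ c)
    (hsum : ∀ ψ : H, Summable (fun i : ℕ => ‖W i ψ‖ ^ 2) ∧
      (∑' i : ℕ, ‖W i ψ‖ ^ 2) ≤ c * ‖ψ‖ ^ 2) :
    ∃ T : H →L[ℂ] H,
      (∀ ψ : H, Tendsto (fun n : ℕ => ∑ i ∈ Finset.range n, W i (b i ψ))
        atTop (nhds (T ψ))) ∧ ‖T‖ ≤ Real.sqrt c := by
  have hle := norm_sum_dressed_fermion_sq_le W W' b (fun i j => (hcomm i j).1)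
    (fun i j => (hcomm i j).2.1) (fun i j => (hcomm i j).2.2.1) (fun i j => (hcomm i j).2.2.2)
    hcar hweyl
  have hsummable (ψ : H) : Summable fun i => W i (b i ψ) := by
    rw [summable_iff_vanishing_norm]
    intro ε hε
    obtain ⟨s, hs⟩ := summable_iff_vanishing_norm.1 (hsum ψ).1 (ε ^ 2) (by positivity)
    refine ⟨s, fun t ht => lt_of_pow_lt_pow_left₀ 2 hε.le ?_⟩
    exact (hle t ψ).trans_lt ((le_abs_self _).trans_lt (hs t ht))
  have htendsto (ψ : H) := (hsummable ψ).hasSum.tendsto_sum_nat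
  let T : H →L[ℂ] H := continuousLinearMapOfTendsto
    (fun n => ∑ i ∈ Finset.range n, W i * b i) (f := fun ψ => ∑' i, W i (b i ψ))
    (tendsto_pi_nhds.2 fun ψ => by simpa [sum_apply] using htendsto ψ)
  refine ⟨T, htendsto, T.opNorm_le_bound (Real.sqrt_nonneg c) fun ψ => ?_⟩
  refine le_of_tendsto (htendsto ψ).norm (Eventually.of_forall fun n => ?_)
  refine le_of_sq_le_sq ?_ (by positivity)
  rw [mul_pow, Real.sq_sqrt hc]
  exact (hle _ ψ).trans (((hsum ψ).1.sum_le_tsum _ fun i _ => sq_nonneg _).trans (hsum ψ).2)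
end

section
/- Let U ⊆ ℝ⁴ be an open set that is a cone (x ∈ U and t > 0 imply t•x ∈ U) and contains the forward light cone { (r, r·ω) : r > 0, ω ∈ S² }, where points of ℝ⁴ are written (x⁰, x⃗) with x⃗ ∈ ℝ³ and S² is the unit sphere in ℝ³. Let α : ℝ⁴ → ℝ be continuously differentiable on U and homogeneous of degree −2 on U, i.e. α(t•x) = t⁻²·α(x) for all x ∈ U and t > 0. For ω ∈ S² set l(ω) = (1, ω) ∈ ℝ⁴ and define the lowered components l₀(ω) = 1 and l_a(ω) = −ω_a for a = 1, 2, 3 (Minkowski metric of signature (+,−,−,−)). Then for all indices a, b ∈ {0, 1, 2, 3}: ∫_{S²} ( l_a(ω) · ∂_b α(l(ω)) − l_b(ω) · ∂_a α(l(ω)) ) dσ(ω) = 0, where ∂_a denotes the partial derivative with respect to the a-th coordinate of ℝ⁴ and σ is the standard surface measure on S². -/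
open MeasureTheory Metric

section Sphere

open Set Module

variable {E : Type*} [NormedAddCommGroup E] [InnerProductSpace ℝ E]

theorem hasFDerivAt_norm_of_ne_zero {x : E} (hx : x ≠ 0) :
    HasFDerivAt (fun y : E => ‖y‖) (‖x‖⁻¹ • innerSL ℝ x) x := by
  have h := (hasStrictFDerivAt_norm_sq x).hasFDerivAt.sqrt (by simpa using hx)
  have hx' : ‖x‖ ≠ 0 := norm_ne_zero_iff.2 hx
  simp only [Real.sqrt_sq (norm_nonneg _)] at h
  convert h using 1
  ext v
  simp
  field_simp

/-- The derivative of a function homogeneous of degree `-m` is homogeneous of degree `-(m + 1)`. -/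
theorem fderiv_smul_of_homogeneous {G : E → ℝ} {m : ℕ}
    (hhom : ∀ x ≠ 0, ∀ t : ℝ, 0 < t → G (t • x) = (t ^ m)⁻¹ * G x)
    {x : E} (hx : x ≠ 0) {t : ℝ} (ht : 0 < t) :
    fderiv ℝ G (t • x) = (t ^ (m + 1))⁻¹ • fderiv ℝ G x := by
  have h : (fun y => G (t • y)) =ᶠ[nhds x] (t ^ m)⁻¹ • G := by
    filter_upwards [isOpen_ne.mem_nhds hx] with y hy
    exact hhom y hy t ht
  have h' := h.fderiv_eq (𝕜 := ℝ)
  rw [fderiv_comp_smul, fderiv_const_smul_field (𝕜 := ℝ), Pi.smul_apply] at h'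
  rw [pow_succ, mul_inv_rev, mul_smul, ← h', inv_smul_smul₀ ht.ne']

/-- A radial cutoff supported away from the origin makes a function that is continuous off the
origin continuous. -/
theorem continuous_comp_norm_mul {V : Type*} [NormedAddCommGroup V] {φ : ℝ → ℝ} {K : V → ℝ}
    (hφ : Continuous φ) (hsupp : tsupport φ ⊆ Ioi 0) (hK : ContinuousOn K {0}ᶜ) :
    Continuous fun x => φ ‖x‖ * K x := by
  rw [continuous_iff_continuousAt]
  intro x
  by_cases hx : x = 0
  · have h0 : φ =ᶠ[nhds ‖x‖] 0 :=
      notMem_tsupport_iff_eventuallyEq.1 fun h => by simpa [hx] using hsupp h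
    have h1 : (fun x => φ ‖x‖ * K x) =ᶠ[nhds x] fun _ => 0 := by
      filter_upwards [continuous_norm.continuousAt.eventually h0] with y hy
      simp [hy]
    exact continuousAt_const.congr h1.symm
  · exact (hφ.comp continuous_norm).continuousAt.mul
      (hK.continuousAt (isOpen_compl_singleton.mem_nhds hx))

theorem hasCompactSupport_comp_norm [FiniteDimensional ℝ E] {φ : ℝ → ℝ}
    (hφ : HasCompactSupport φ) : HasCompactSupport fun x : E => φ ‖x‖ := by
  obtain ⟨R, hR⟩ := hφ.isCompact.isBounded.subset_closedBall (0 : ℝ)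
  refine HasCompactSupport.intro (isCompact_closedBall (0 : E) R) fun x hx => ?_
  refine image_eq_zero_of_notMem_tsupport fun h => hx ?_
  simpa using hR h

theorem integral_fderiv_apply_eq_zero [FiniteDimensional ℝ E] [MeasurableSpace E] [BorelSpace E]
    (μ : Measure E) [μ.IsAddHaarMeasure] {f : E → ℝ} (hf : Differentiable ℝ f)
    (hint : Integrable f μ) {v : E} (hint' : Integrable (fun x => fderiv ℝ f x v) μ) :
    ∫ x, fderiv ℝ f x v ∂μ = 0 := by
  simpa using integral_mul_fderiv_eq_neg_fderiv_mul_of_integrable (μ := μ) (f := fun _ => (1 : ℝ))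
    (g := f) (v := v) (by simp) (by simpa using hint') (by simpa using hint)
    (fun _ _ => differentiableAt_const _) fun x _ => hf x

theorem integral_mul_comp_norm [Nontrivial E] [FiniteDimensional ℝ E] [MeasurableSpace E]
    [BorelSpace E] (μ : Measure E) [μ.IsAddHaarMeasure] (A : E → ℝ) (B : ℝ → ℝ) :
    ∫ x, A (‖x‖⁻¹ • x) * B ‖x‖ ∂μ
      = (∫ ω : sphere (0 : E) 1, A ω ∂μ.toSphere)
        * ∫ r in Ioi (0 : ℝ), r ^ (finrank ℝ E - 1) * B r :=
  calc
    _ = ∫ x : ({(0)}ᶜ : Set E), A (‖x.1‖⁻¹ • x.1) * B ‖x.1‖ ∂(μ.comap (↑)) := by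
      rw [integral_subtype_comap (measurableSet_singleton _).compl
        fun x => A (‖x‖⁻¹ • x) * B ‖x‖, restrict_compl_singleton]
    _ = ∫ p, A p.1 * B p.2 ∂μ.toSphere.prod (.volumeIoiPow (finrank ℝ E - 1)) := by
      simpa using μ.measurePreserving_homeomorphUnitSphereProd.integral_comp
        (Homeomorph.measurableEmbedding _)
        fun p : sphere (0 : E) 1 × Ioi (0 : ℝ) => A p.1 * B p.2
    _ = (∫ ω : sphere (0 : E) 1, A ω ∂μ.toSphere)
        * ∫ r : Ioi (0 : ℝ), B r ∂.volumeIoiPow (finrank ℝ E - 1) :=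
      integral_prod_mul (fun ω : sphere (0 : E) 1 => A ω) fun r : Ioi (0 : ℝ) => B r
    _ = _ := by
      simp only [Measure.volumeIoiPow, ENNReal.ofReal]
      rw [integral_withDensity_eq_integral_smul,
        integral_subtype_comap measurableSet_Ioi
          fun a => Real.toNNReal (a ^ (finrank ℝ E - 1)) • B a,
        setIntegral_congr_fun measurableSet_Ioi fun x hx => ?_]
      · rw [NNReal.smul_def, Real.coe_toNNReal _ (pow_nonneg hx.out.le _), smul_eq_mul]
      · exact (measurable_subtype_coe.pow_const _).real_toNNReal

/-- On the unit sphere of an `(m + 1)`-dimensional space, the directional derivatives of a function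
homogeneous of degree `-m` integrate to zero. -/
theorem integral_sphere_fderiv_eq_zero [Nontrivial E] [FiniteDimensional ℝ E] [MeasurableSpace E]
    [BorelSpace E] (μ : Measure E) [μ.IsAddHaarMeasure] {G : E → ℝ}
    (hG : ContDiffOn ℝ 1 G {0}ᶜ)
    (hhom : ∀ x ≠ 0, ∀ t : ℝ, 0 < t → G (t • x) = (t ^ (finrank ℝ E - 1))⁻¹ * G x) (v : E) :
    ∫ ω : sphere (0 : E) 1, fderiv ℝ G ω v ∂μ.toSphere = 0 := by
  set m := finrank ℝ E - 1
  let φ : ContDiffBump (2 : ℝ) := ⟨1 / 2, 1, by norm_num, by norm_num⟩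
  have hφd : ∀ r, HasDerivAt φ (deriv φ r) r := fun r =>
    ((φ.contDiff (n := 1)).differentiable one_ne_zero r).hasDerivAt
  have hφ' : Continuous (deriv φ) := (φ.contDiff (n := 1)).continuous_deriv le_rfl
  have hsupp : tsupport φ ⊆ Ioi 0 := by
    rw [φ.tsupport_eq]
    intro r hr
    rw [Real.closedBall_eq_Icc] at hr
    change r ∈ Icc (2 - 1 : ℝ) (2 + 1) at hr
    exact lt_of_lt_of_le (by norm_num) hr.1
  have hsupp' : tsupport (deriv φ) ⊆ Ioi 0 :=
    (closure_minimal support_deriv_subset isClosed_closure).trans hsupp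
  have hGd : ∀ x ≠ 0, DifferentiableAt ℝ G x := fun x hx =>
    (hG.differentiableOn one_ne_zero).differentiableAt (isOpen_compl_singleton.mem_nhds hx)
  have hGc : ContinuousOn (fun x => fderiv ℝ G x v) {0}ᶜ :=
    (hG.continuousOn_fderiv_of_isOpen isOpen_compl_singleton le_rfl).clm_apply continuousOn_const
  have hKc : ContinuousOn (fun x : E => ‖x‖⁻¹ * inner ℝ x v * G x) {0}ᶜ := by
    refine ((continuousOn_id.norm.inv₀ fun x hx => norm_ne_zero_iff.2 hx).mul ?_).mul
      hG.continuousOn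
    fun_prop
  have hint₁ : Integrable (fun x : E => deriv φ ‖x‖ * (‖x‖⁻¹ * inner ℝ x v * G x)) μ :=
    (continuous_comp_norm_mul hφ' hsupp' hKc).integrable_of_hasCompactSupport
      (hasCompactSupport_comp_norm φ.hasCompactSupport.deriv).mul_right
  have hint₂ : Integrable (fun x : E => φ ‖x‖ * fderiv ℝ G x v) μ :=
    (continuous_comp_norm_mul φ.continuous hsupp hGc).integrable_of_hasCompactSupport
      (hasCompactSupport_comp_norm φ.hasCompactSupport).mul_right
  have hint₀ : Integrable (fun x : E => φ ‖x‖ * G x) μ :=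
    (continuous_comp_norm_mul φ.continuous hsupp hG.continuousOn).integrable_of_hasCompactSupport
      (hasCompactSupport_comp_norm φ.hasCompactSupport).mul_right
  have hderiv : ∀ x : E, ∃ L : E →L[ℝ] ℝ, HasFDerivAt (fun x : E => φ ‖x‖ * G x) L x ∧
      L v = deriv φ ‖x‖ * (‖x‖⁻¹ * inner ℝ x v * G x) + φ ‖x‖ * fderiv ℝ G x v := by
    intro x
    by_cases hx : x = 0
    · have hn : ‖x‖ ∉ tsupport φ := fun h => by simpa [hx] using hsupp h
      have hn' : ‖x‖ ∉ tsupport (deriv φ) := fun h => by simpa [hx] using hsupp' h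
      have h1 : (fun x => φ ‖x‖ * G x) =ᶠ[nhds x] fun _ => 0 := by
        filter_upwards [continuous_norm.continuousAt.eventually
          (notMem_tsupport_iff_eventuallyEq.1 hn)] with y hy
        simp [hy]
      refine ⟨0, (hasFDerivAt_const (0 : ℝ) x).congr_of_eventuallyEq h1, ?_⟩
      rw [image_eq_zero_of_notMem_tsupport hn, image_eq_zero_of_notMem_tsupport hn']
      simp
    · refine ⟨_, ((hφd ‖x‖).comp_hasFDerivAt x (hasFDerivAt_norm_of_ne_zero hx)).mul
        (hGd x hx).hasFDerivAt, ?_⟩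
      simp
      ring
  have hfd : ∀ x : E, fderiv ℝ (fun x : E => φ ‖x‖ * G x) x v
      = deriv φ ‖x‖ * (‖x‖⁻¹ * inner ℝ x v * G x) + φ ‖x‖ * fderiv ℝ G x v := by
    intro x
    obtain ⟨L, hL, hLv⟩ := hderiv x
    rw [hL.fderiv, hLv]
  have hzero := integral_fderiv_apply_eq_zero μ (f := fun x : E => φ ‖x‖ * G x) (v := v)
    (fun x => (hderiv x).choose_spec.1.differentiableAt) hint₀
    ((hint₁.add hint₂).congr (.of_forall fun x => (hfd x).symm))
  simp only [hfd] at hzero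
  rw [integral_add hint₁ hint₂] at hzero
  have hφint : ∫ r in Ioi (0 : ℝ), deriv φ r = 0 := by
    rw [setIntegral_eq_integral_of_forall_compl_eq_zero fun r hr =>
      image_eq_zero_of_notMem_tsupport fun h => hr (hsupp' h)]
    exact integral_eq_zero_of_hasDerivAt_of_integrable hφd
      (hφ'.integrable_of_hasCompactSupport φ.hasCompactSupport.deriv)
      (φ.continuous.integrable_of_hasCompactSupport φ.hasCompactSupport)
  have hscale : ∀ x : E, x ≠ 0 → ∃ ω : E, ω ≠ 0 ∧ ‖x‖⁻¹ • x = ω ∧ x = ‖x‖ • ω := fun x hx =>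
    ⟨‖x‖⁻¹ • x, smul_ne_zero (inv_ne_zero (norm_ne_zero_iff.2 hx)) hx, rfl,
      (smul_inv_smul₀ (norm_ne_zero_iff.2 hx) x).symm⟩
  have h₁ : ∫ x, deriv φ ‖x‖ * (‖x‖⁻¹ * inner ℝ x v * G x) ∂μ = 0 := by
    have hpolar := integral_mul_comp_norm μ (fun ω : E => inner ℝ ω v * G ω)
      fun r => deriv φ r * (r ^ m)⁻¹
    have hrad : ∫ r in Ioi (0 : ℝ), r ^ m * (deriv φ r * (r ^ m)⁻¹) = 0 := by
      refine (setIntegral_congr_fun measurableSet_Ioi fun r (hr : 0 < r) => ?_).trans hφint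
      field_simp
    rw [hrad, mul_zero] at hpolar
    rw [← hpolar]
    refine integral_congr_ae ?_
    filter_upwards [Measure.ae_ne μ 0] with x hx
    have hr : 0 < ‖x‖ := norm_pos_iff.2 hx
    obtain ⟨ω, hω, h1, h2⟩ := hscale x hx
    have hGx : G x = (‖x‖ ^ m)⁻¹ * G ω := by
      conv_lhs => rw [h2]
      exact hhom ω hω _ hr
    rw [hGx, h1, ← h1, real_inner_smul_left]
    ring
  have h₂ : ∫ x, φ ‖x‖ * fderiv ℝ G x v ∂μ
      = (∫ ω : sphere (0 : E) 1, fderiv ℝ G ω v ∂μ.toSphere)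
        * ∫ r in Ioi (0 : ℝ), r ^ m * (φ r * (r ^ (m + 1))⁻¹) := by
    rw [← integral_mul_comp_norm μ (fun ω : E => fderiv ℝ G ω v) fun r => φ r * (r ^ (m + 1))⁻¹]
    refine integral_congr_ae ?_
    filter_upwards [Measure.ae_ne μ 0] with x hx
    have hr : 0 < ‖x‖ := norm_pos_iff.2 hx
    obtain ⟨ω, hω, h1, h2⟩ := hscale x hx
    have hGx : fderiv ℝ G x = (‖x‖ ^ (m + 1))⁻¹ • fderiv ℝ G ω := by
      conv_lhs => rw [h2]
      exact fderiv_smul_of_homogeneous hhom hω hr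
    rw [hGx, h1]
    simp only [smul_apply, smul_eq_mul]
    ring
  have hpos : 0 < ∫ r in Ioi (0 : ℝ), r ^ m * (φ r * (r ^ (m + 1))⁻¹) := by
    have hinv : Continuous fun r => φ r * r⁻¹ := by
      refine continuous_of_tsupport fun r hr => ?_
      have hr' : 0 < r := hsupp (tsupport_mul_subset_left hr)
      exact φ.continuous.continuousAt.mul (continuousAt_inv₀ hr'.ne')
    have hneg : ∀ r ∉ Ioi (0 : ℝ), φ r * r⁻¹ = 0 := fun r hr => by
      rw [image_eq_zero_of_notMem_tsupport fun h => hr (hsupp h), zero_mul]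
    have h := hinv.integral_pos_of_hasCompactSupport_nonneg_nonzero (μ := volume) (x := 2)
      φ.hasCompactSupport.mul_right
      (fun r => by
        by_cases hr : r ∈ Ioi (0 : ℝ)
        · exact mul_nonneg φ.nonneg (inv_nonneg.2 (le_of_lt hr))
        · exact (hneg r hr).ge)
      (by simp [φ.one_of_mem_closedBall (mem_closedBall_self φ.rIn_pos.le)])
    rw [← setIntegral_eq_integral_of_forall_compl_eq_zero hneg] at h
    refine h.trans_eq (setIntegral_congr_fun measurableSet_Ioi fun r (hr : 0 < r) => ?_)
    field_simp
    ring
  rw [h₁, h₂, zero_add] at hzero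
  exact (mul_eq_zero.1 hzero).resolve_right hpos.ne'

end Sphere

section LightCone

/-- The inclusion of space into Minkowski space as the slice of vanishing time. -/
noncomputable def spaceInclusion : EuclideanSpace ℝ (Fin 3) →L[ℝ] EuclideanSpace ℝ (Fin 4) :=
  ∑ j : Fin 3, (EuclideanSpace.proj j : EuclideanSpace ℝ (Fin 3) →L[ℝ] ℝ).smulRight
    (EuclideanSpace.single j.succ (1 : ℝ))

theorem spaceInclusion_single (j : Fin 3) :
    spaceInclusion (EuclideanSpace.single j 1) = EuclideanSpace.single j.succ 1 := by
  simp [spaceInclusion, ite_smul]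

/-- The point of the forward light cone lying over a given point of space. -/
noncomputable def lightConeLift (x : EuclideanSpace ℝ (Fin 3)) : EuclideanSpace ℝ (Fin 4) :=
  ‖x‖ • EuclideanSpace.single 0 1 + spaceInclusion x

theorem lightConeLift_apply_zero (x : EuclideanSpace ℝ (Fin 3)) : lightConeLift x 0 = ‖x‖ := by
  simp [lightConeLift, spaceInclusion]

theorem lightConeLift_apply_succ (x : EuclideanSpace ℝ (Fin 3)) (j : Fin 3) :
    lightConeLift x j.succ = x j := by
  simp [lightConeLift, spaceInclusion, Pi.single_apply]

theorem lightConeLift_eq_cons (x : EuclideanSpace ℝ (Fin 3)) :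
    lightConeLift x = (WithLp.equiv 2 (Fin 4 → ℝ)).symm (Fin.cons ‖x‖ fun b => x b) := by
  ext i
  refine Fin.cases ?_ (fun j => ?_) i
  · exact lightConeLift_apply_zero x
  · exact lightConeLift_apply_succ x j

theorem lightConeLift_smul {t : ℝ} (ht : 0 < t) (x : EuclideanSpace ℝ (Fin 3)) :
    lightConeLift (t • x) = t • lightConeLift x := by
  simp [lightConeLift, norm_smul, abs_of_pos ht, smul_smul]

theorem hasFDerivAt_lightConeLift {x : EuclideanSpace ℝ (Fin 3)} (hx : x ≠ 0) :
    HasFDerivAt lightConeLift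
      ((‖x‖⁻¹ • innerSL ℝ x).smulRight (EuclideanSpace.single 0 1) + spaceInclusion) x :=
  ((hasFDerivAt_norm_of_ne_zero hx).smul_const _).add spaceInclusion.hasFDerivAt

theorem contDiffOn_lightConeLift : ContDiffOn ℝ 1 lightConeLift {0}ᶜ := by
  refine ContDiffOn.add (ContDiffOn.smul (contDiffOn_id.norm ℝ fun x hx => hx) contDiffOn_const) ?_
  exact spaceInclusion.contDiff.contDiffOn

theorem fderiv_comp_lightConeLift {α : EuclideanSpace ℝ (Fin 4) → ℝ}
    {ω : EuclideanSpace ℝ (Fin 3)} (hω : ‖ω‖ = 1)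
    (hα : DifferentiableAt ℝ α (lightConeLift ω)) (j : Fin 3) :
    fderiv ℝ (α ∘ lightConeLift) ω (EuclideanSpace.single j 1)
      = ω j * fderiv ℝ α (lightConeLift ω) (EuclideanSpace.single 0 1)
        + fderiv ℝ α (lightConeLift ω) (EuclideanSpace.single j.succ 1) := by
  have hω₀ : ω ≠ 0 := norm_ne_zero_iff.1 (by simp [hω])
  rw [(hα.hasFDerivAt.comp ω (hasFDerivAt_lightConeLift hω₀)).fderiv]
  simp [spaceInclusion_single, hω, EuclideanSpace.inner_single_right]

end LightCone

section Rotation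

variable {ι : Type*} [Fintype ι] [DecidableEq ι] {F : EuclideanSpace ℝ ι → ℝ}

theorem fderiv_inv_norm_mul_coord_mul {ω : EuclideanSpace ℝ ι} (hω : ‖ω‖ = 1)
    (hF : DifferentiableAt ℝ F ω) (i j : ι) :
    fderiv ℝ (fun x => ‖x‖⁻¹ * x j * F x) ω (EuclideanSpace.single i 1)
      = (if j = i then F ω else 0) - ω i * ω j * F ω
        + ω j * fderiv ℝ F ω (EuclideanSpace.single i 1) := by
  have hω₀ : ω ≠ 0 := norm_ne_zero_iff.1 (by simp [hω])
  have hinv := (hasDerivAt_inv (norm_ne_zero_iff.2 hω₀)).comp_hasFDerivAt ω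
    (hasFDerivAt_norm_of_ne_zero hω₀)
  have hcoord := (EuclideanSpace.proj j : EuclideanSpace ℝ ι →L[ℝ] ℝ).hasFDerivAt (x := ω)
  have h : HasFDerivAt (fun x => ‖x‖⁻¹ * x j * F x) _ ω := (hinv.mul hcoord).mul hF.hasFDerivAt
  rw [h.fderiv]
  simp [hω, EuclideanSpace.inner_single_right]
  split_ifs <;> ring

/-- Infinitesimal rotation invariance of the surface measure of the sphere, for the restrictions of
homogeneous functions. -/
theorem integral_sphere_rotation_eq_zero [Nontrivial ι] (hF : ContDiffOn ℝ 1 F {0}ᶜ)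
    (hhom : ∀ x ≠ 0, ∀ t : ℝ, 0 < t → F (t • x) = (t ^ (Fintype.card ι - 1))⁻¹ * F x) (i j : ι) :
    ∫ ω : sphere (0 : EuclideanSpace ℝ ι) 1,
      ((ω : EuclideanSpace ℝ ι) j * fderiv ℝ F ω (EuclideanSpace.single i 1)
        - (ω : EuclideanSpace ℝ ι) i * fderiv ℝ F ω (EuclideanSpace.single j 1))
      ∂(volume : Measure (EuclideanSpace ℝ ι)).toSphere = 0 := by
  let G : ι → EuclideanSpace ℝ ι → ℝ := fun k x => ‖x‖⁻¹ * x k * F x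
  have hG : ∀ k, ContDiffOn ℝ 1 (G k) {0}ᶜ := fun k => by
    refine ContDiffOn.mul (ContDiffOn.mul ((contDiffOn_id.norm ℝ fun x hx => hx).inv
      fun x hx => norm_ne_zero_iff.2 hx) ?_) hF
    exact (EuclideanSpace.proj k : EuclideanSpace ℝ ι →L[ℝ] ℝ).contDiff.contDiffOn
  have hGhom : ∀ k, ∀ x ≠ 0, ∀ t : ℝ, 0 < t →
      G k (t • x) = (t ^ (Module.finrank ℝ (EuclideanSpace ℝ ι) - 1))⁻¹ * G k x := by
    intro k x hx t ht
    simp only [G, hhom x hx t ht, norm_smul, Real.norm_eq_abs, abs_of_pos ht, PiLp.smul_apply,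
      smul_eq_mul, finrank_euclideanSpace]
    field_simp
  have hzero : ∀ k l, ∫ ω : sphere (0 : EuclideanSpace ℝ ι) 1,
      fderiv ℝ (G k) ω (EuclideanSpace.single l 1)
        ∂(volume : Measure (EuclideanSpace ℝ ι)).toSphere = 0 := fun k l =>
    integral_sphere_fderiv_eq_zero volume (hG k) (hGhom k) _
  have hne : ∀ ω : sphere (0 : EuclideanSpace ℝ ι) 1, (ω : EuclideanSpace ℝ ι) ∈ ({0}ᶜ : Set _) :=
    fun ω => ne_zero_of_mem_unit_sphere ω
  have hint : ∀ k l, Integrable (fun ω : sphere (0 : EuclideanSpace ℝ ι) 1 =>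
      fderiv ℝ (G k) ω (EuclideanSpace.single l 1))
        (volume : Measure (EuclideanSpace ℝ ι)).toSphere := fun k l => by
    have hc : Continuous fun ω : sphere (0 : EuclideanSpace ℝ ι) 1 =>
        fderiv ℝ (G k) ω (EuclideanSpace.single l 1) :=
      (((hG k).continuousOn_fderiv_of_isOpen isOpen_compl_singleton le_rfl).comp_continuous
        continuous_subtype_val hne).clm_apply continuous_const
    exact hc.integrable_of_hasCompactSupport (.of_compactSpace _)
  calc
    _ = ∫ ω : sphere (0 : EuclideanSpace ℝ ι) 1,
        (fderiv ℝ (G j) ω (EuclideanSpace.single i 1)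
          - fderiv ℝ (G i) ω (EuclideanSpace.single j 1))
        ∂(volume : Measure (EuclideanSpace ℝ ι)).toSphere := by
      refine integral_congr_ae (.of_forall fun ω => ?_)
      have hd : DifferentiableAt ℝ F ω := (hF.differentiableOn one_ne_zero).differentiableAt
        (isOpen_compl_singleton.mem_nhds (hne ω))
      simp only [G]
      rw [fderiv_inv_norm_mul_coord_mul (norm_eq_of_mem_sphere ω) hd,
        fderiv_inv_norm_mul_coord_mul (norm_eq_of_mem_sphere ω) hd]
      simp only [eq_comm (a := j) (b := i)]
      ring
    _ = 0 := by rw [integral_sub (hint j i) (hint i j), hzero, hzero, sub_zero]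

end Rotation

theorem integral_tangential_antisym_deriv_zero
    (U : Set (EuclideanSpace ℝ (Fin 4)))
    (hUopen : IsOpen U)
    (hUcone : ∀ x ∈ U, ∀ t : ℝ, 0 < t → t • x ∈ U)
    (hUlight : ∀ r : ℝ, 0 < r → ∀ ω : EuclideanSpace ℝ (Fin 3), ‖ω‖ = 1 →
      (WithLp.equiv 2 (Fin 4 → ℝ)).symm (Fin.cons r fun b => r * ω b) ∈ U)
    (α : EuclideanSpace ℝ (Fin 4) → ℝ)
    (hα : ContDiffOn ℝ 1 α U)
    (hhom : ∀ x ∈ U, ∀ t : ℝ, 0 < t → α (t • x) = (t ^ 2)⁻¹ * α x)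
    (l : sphere (0 : EuclideanSpace ℝ (Fin 3)) 1 → EuclideanSpace ℝ (Fin 4))
    (hl : ∀ ω : sphere (0 : EuclideanSpace ℝ (Fin 3)) 1,
      l ω = (WithLp.equiv 2 (Fin 4 → ℝ)).symm
        (Fin.cons 1 fun b => (ω : EuclideanSpace ℝ (Fin 3)) b))
    (low : EuclideanSpace ℝ (Fin 4) → Fin 4 → ℝ)
    (hlow : ∀ (x : EuclideanSpace ℝ (Fin 4)) (a : Fin 4),
      low x a = if a = 0 then x a else -(x a)) :
    ∀ a b : Fin 4,
      ∫ ω : sphere (0 : EuclideanSpace ℝ (Fin 3)) 1,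
        (low (l ω) a * fderiv ℝ α (l ω) (EuclideanSpace.single b 1)
          - low (l ω) b * fderiv ℝ α (l ω) (EuclideanSpace.single a 1))
        ∂((volume : Measure (EuclideanSpace ℝ (Fin 3))).toSphere) = 0 := by
  have hlift : ∀ x : EuclideanSpace ℝ (Fin 3), x ≠ 0 → lightConeLift x ∈ U := by
    intro x hx
    have hn : ‖x‖ ≠ 0 := norm_ne_zero_iff.2 hx
    have h := hUlight ‖x‖ (norm_pos_iff.2 hx) (‖x‖⁻¹ • x) (by simp [norm_smul, hn])
    rw [lightConeLift_eq_cons]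
    convert h using 4
    simp [hn]
  have hl' : ∀ ω, l ω = lightConeLift ω := fun ω => by
    rw [hl, lightConeLift_eq_cons, norm_eq_of_mem_sphere]
  have hd : ∀ ω : sphere (0 : EuclideanSpace ℝ (Fin 3)) 1,
      DifferentiableAt ℝ α (lightConeLift ω) := fun ω =>
    (hα.differentiableOn one_ne_zero).differentiableAt
      (hUopen.mem_nhds (hlift ω (ne_zero_of_mem_unit_sphere ω)))
  have hF : ContDiffOn ℝ 1 (α ∘ lightConeLift) {0}ᶜ :=
    hα.comp contDiffOn_lightConeLift fun x hx => hlift x hx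
  have hFhom : ∀ x ≠ 0, ∀ t : ℝ, 0 < t →
      (α ∘ lightConeLift) (t • x) = (t ^ 2)⁻¹ * (α ∘ lightConeLift) x := fun x hx t ht => by
    simp only [Function.comp_apply, lightConeLift_smul ht]
    exact hhom _ (hlift x hx) t ht
  have hzero : ∀ j : Fin 3, ∫ ω : sphere (0 : EuclideanSpace ℝ (Fin 3)) 1,
      fderiv ℝ (α ∘ lightConeLift) ω (EuclideanSpace.single j 1)
        ∂(volume : Measure (EuclideanSpace ℝ (Fin 3))).toSphere = 0 := fun j =>
    integral_sphere_fderiv_eq_zero volume hF (by simpa using hFhom) _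
  have hlow₀ : ∀ ω, low (l ω) 0 = 1 := fun ω => by
    rw [hlow, if_pos rfl, hl', lightConeLift_apply_zero, norm_eq_of_mem_sphere]
  have hlowS : ∀ ω (j : Fin 3), low (l ω) j.succ = -(ω : EuclideanSpace ℝ (Fin 3)) j :=
    fun ω j => by rw [hlow, if_neg j.succ_ne_zero, hl', lightConeLift_apply_succ]
  have hpartial : ∀ (ω : sphere (0 : EuclideanSpace ℝ (Fin 3)) 1) (j : Fin 3),
      fderiv ℝ α (l ω) (EuclideanSpace.single j.succ 1)
        = fderiv ℝ (α ∘ lightConeLift) ω (EuclideanSpace.single j 1)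
          - (ω : EuclideanSpace ℝ (Fin 3)) j
            * fderiv ℝ α (l ω) (EuclideanSpace.single 0 1) := fun ω j => by
    rw [fderiv_comp_lightConeLift (norm_eq_of_mem_sphere ω) (hd ω), hl']
    ring
  intro a b
  refine Fin.cases ?_ (fun i => ?_) a <;> refine Fin.cases ?_ (fun j => ?_) b
  · simp
  · rw [← hzero j]
    refine integral_congr_ae (.of_forall fun ω => ?_)
    simp only [hlow₀, hlowS, hpartial]
    ring
  · rw [← neg_eq_zero, ← integral_neg, ← hzero i]
    refine integral_congr_ae (.of_forall fun ω => ?_)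
    simp only [hlow₀, hlowS, hpartial]
    ring
  · rw [← integral_sphere_rotation_eq_zero hF (by simpa using hFhom) i j]
    refine integral_congr_ae (.of_forall fun ω => ?_)
    simp only [hlowS, hpartial]
    ring
end
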